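/- arXiv:1310.6565 — 2 statements merged into one kernel-verified Lean document; each statement's English description precedes it below -/
import Mathlib

section
/- For every m ∈ ℕ, any finite subgroup H of the torus (S¹)^m can be generated by at most m elements. -/
/-- An extension of a cyclic group by a group generated by `n` elements is generated by at most
`n + 1` elements. -/
theorem exists_finset_closure_eq_top_of_ker {G H : Type*} [Group G] [Group H] (f : G →* H)
    [IsCyclic f.range] (S : Finset f.ker) (hS : Subgroup.closure (S : Set f.ker) = ⊤) :
    ∃ T : Finset G, Subgroup.closure (T : Set G) = ⊤ ∧ T.card ≤ S.card + 1 := by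
  classical
  obtain ⟨⟨_, g, rfl⟩, hg⟩ := IsCyclic.exists_generator (α := f.range)
  refine ⟨insert g (S.image Subtype.val), ?_,
    (Finset.card_insert_le _ _).trans (Nat.add_le_add_right Finset.card_image_le 1)⟩
  rw [Finset.coe_insert, Finset.coe_image]
  set L := Subgroup.closure (insert g (Subtype.val '' (S : Set f.ker)))
  have hker : f.ker ≤ L := by
    have h := congrArg (Subgroup.map f.ker.subtype) hS
    rw [MonoidHom.map_closure, ← MonoidHom.range_eq_map, Subgroup.range_subtype] at h
    rw [← h]
    exact Subgroup.closure_mono (Set.subset_insert _ _)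
  have hgL : g ∈ L := Subgroup.subset_closure (Set.mem_insert _ _)
  refine (Subgroup.eq_top_iff' L).2 fun x => ?_
  obtain ⟨k, hk⟩ := Subgroup.mem_zpowers_iff.1 (hg ⟨f x, x, rfl⟩)
  have hk' : f g ^ k = f x := congrArg Subtype.val hk
  have hx : (g ^ k)⁻¹ * x ∈ L := hker (by simp [MonoidHom.mem_ker, hk'])
  simpa using L.mul_mem (L.zpow_mem hgL k) hx

/-- A finite group embedding in `(S¹)^m` is generated by at most `m` elements. -/
theorem exists_finset_closure_eq_top_of_injective_torus (m : ℕ) {G : Type*} [Group G] [Finite G]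
    (f : G →* (Fin m → Circle)) (hf : Function.Injective f) :
    ∃ S : Finset G, Subgroup.closure (S : Set G) = ⊤ ∧ S.card ≤ m := by
  induction m generalizing G with
  | zero =>
    have : Subsingleton G := hf.subsingleton
    exact ⟨∅, Subsingleton.elim _ _, le_rfl⟩
  | succ m ih =>
    let p : G →* Circle := (Pi.evalMonoidHom (fun _ => Circle) 0).comp f
    let q : p.ker →* (Fin m → Circle) :=
      (MonoidHom.pi fun i => (Pi.evalMonoidHom (fun _ => Circle) i.succ).comp f).comp
        p.ker.subtype
    have hq : Function.Injective q := by
      intro x y hxy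
      refine Subtype.ext (hf (funext fun i => ?_))
      refine Fin.cases ?_ (fun j => congrFun hxy j) i
      exact (MonoidHom.mem_ker.1 x.2).trans (MonoidHom.mem_ker.1 y.2).symm
    have : Finite p.range := Finite.of_surjective _ p.rangeRestrict_surjective
    have : IsCyclic p.range :=
      isCyclic_of_injective_ringHom (Circle.coeHom.comp p.range.subtype)
        (Circle.coe_injective.comp Subtype.val_injective)
    obtain ⟨S, hS, hcard⟩ := ih q hq
    obtain ⟨T, hT, hTcard⟩ := exists_finset_closure_eq_top_of_ker p S hS
    exact ⟨T, hT, hTcard.trans (Nat.add_le_add_right hcard 1)⟩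

/-- For every `m`, any finite subgroup of the torus `(S¹)^m` can be
generated by at most `m` elements. -/
theorem finite_subgroup_of_torus (m : ℕ) (K : Subgroup (Fin m → Circle)) (hK : Finite K) :
    ∃ S : Finset K, Subgroup.closure (S : Set K) = ⊤ ∧ S.card ≤ m :=
  exists_finset_closure_eq_top_of_injective_torus m K.subtype K.subtype_injective
end

section
/- There exists a function C_Δ : ℕ × ℕ → ℕ with the following property: whenever d, e_1, …, e_l, a ∈ ℕ and t ∈ ℤ satisfy e_1 ≥ e_2 ≥ ⋯ ≥ e_l, each e_j divides d, and d/e_1 + d/e_2 + ⋯ + d/e_l − 1 = d·t/a, then e_1 ≥ d / C_Δ(l, a). -/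
/-- If `∑ 1/eᵢ - 1/d = t/a` with `e` antitone, bounded by `d`, and `a ≤ A`, then `d / e₀` is bounded
in terms of the number of summands and `A`. -/
theorem exists_bound_of_sum_inv_sub_inv_eq (l A : ℕ) :
    ∃ B : ℕ, 0 < B ∧ ∀ (d a : ℕ) (e : Fin (l + 1) → ℕ) (t : ℤ),
      0 < d → 0 < a → a ≤ A → (∀ i, 0 < e i) → Antitone e → (∀ i, e i ≤ d) →
      ∑ i, (1 : ℚ) / e i - 1 / d = t / a → d ≤ B * e 0 := by
  induction l generalizing A with
  | zero =>
    refine ⟨A + 1, by omega, fun d a e t hd ha haA he _ _ h => ?_⟩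
    have hd' : (0 : ℚ) < d := by exact_mod_cast hd
    have ha' : (0 : ℚ) < a := by exact_mod_cast ha
    have he' : (0 : ℚ) < e 0 := by exact_mod_cast he 0
    have hz : (d : ℤ) * a - e 0 * a = t * (e 0 * d) := by
      have : ((d : ℚ) * a - e 0 * a) = t * (e 0 * d) := by
        rw [Fin.sum_univ_one] at h
        field_simp at h
        linarith
      exact_mod_cast this
    have : d ≤ a * e 0 := by
      have hdvd : (d : ℤ) ∣ e 0 * a := ⟨a - t * e 0, by linarith⟩
      have := Int.le_of_dvd (mul_pos (by exact_mod_cast he 0) (by exact_mod_cast ha)) hdvd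
      rw [mul_comm]
      exact_mod_cast this
    exact this.trans (Nat.mul_le_mul_right _ (by omega))
  | succ l ih =>
    obtain ⟨B, hB, hbound⟩ := ih (A * ((l + 2) * A))
    refine ⟨B, hB, fun d a e t hd ha haA he hanti hed h => ?_⟩
    have hd' : (0 : ℚ) < d := by exact_mod_cast hd
    have ha' : (0 : ℚ) < a := by exact_mod_cast ha
    have he' : ∀ i, (0 : ℚ) < e i := fun i => by exact_mod_cast he i
    have hlast := he' (Fin.last (l + 1))
    have hpos : 0 < t := by
      have h1 : (1 : ℚ) / d ≤ 1 / e 0 :=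
        one_div_le_one_div_of_le (he' 0) (by exact_mod_cast hed 0)
      have h2 : (0 : ℚ) < ∑ i : Fin (l + 1), (1 : ℚ) / e i.succ :=
        Finset.sum_pos (fun i _ => one_div_pos.2 (he' _)) Finset.univ_nonempty
      rw [Fin.sum_univ_succ] at h
      have h3 : (0 : ℚ) < t / a := by linarith
      have h4 := (div_pos_iff_of_pos_right ha').1 h3
      exact_mod_cast h4
    have hsmall : e (Fin.last (l + 1)) ≤ (l + 2) * a := by
      have h1 : ∑ i, (1 : ℚ) / e i ≤ (l + 2) / e (Fin.last (l + 1)) := by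
        calc ∑ i, (1 : ℚ) / e i ≤ ∑ _i : Fin (l + 1 + 1), (1 : ℚ) / e (Fin.last (l + 1)) :=
              Finset.sum_le_sum fun i _ => one_div_le_one_div_of_le hlast
                (by exact_mod_cast hanti (Fin.le_last i))
          _ = (l + 2) / e (Fin.last (l + 1)) := by
              rw [Finset.sum_const, Finset.card_univ, Fintype.card_fin, nsmul_eq_mul]
              push_cast
              ring
      have h2 : (1 : ℚ) / a ≤ t / a := by
        gcongr
        exact_mod_cast hpos
      have h3 : (0 : ℚ) < 1 / d := by positivity
      have h4 : (1 : ℚ) / a ≤ (l + 2) / e (Fin.last (l + 1)) := by linarith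
      rw [div_le_div_iff₀ ha' hlast, one_mul] at h4
      exact_mod_cast h4
    refine hbound d (a * e (Fin.last (l + 1))) (fun i => e i.castSucc)
      (t * e (Fin.last (l + 1)) - a) hd (Nat.mul_pos ha (he _)) ?_ (fun _ => he _)
      (fun i j hij => hanti (Fin.castSucc_le_castSucc_iff.2 hij)) (fun _ => hed _) ?_
    · exact Nat.mul_le_mul haA (hsmall.trans (Nat.mul_le_mul_left _ haA))
    · rw [Fin.sum_univ_castSucc] at h
      have h1 : (((t * e (Fin.last (l + 1)) - a : ℤ) : ℚ)) / ((a * e (Fin.last (l + 1)) : ℕ) : ℚ)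
          = t / a - 1 / e (Fin.last (l + 1)) := by
        push_cast
        field_simp
      rw [h1]
      linarith

/-- **arithmetic lemma.** There is a function `C_Δ : ℕ × ℕ → ℕ` (with
positive values) such that whenever positive integers `d, e₁ ≥ e₂ ≥ ⋯ ≥ e_l, a` and an
integer `t` satisfy that each `e_j` divides `d` and
`d/e₁ + ⋯ + d/e_l − 1 = d·t/a`, then `e₁ ≥ d / C_Δ(l, a)`. -/
theorem arithmetic_lemma :
    ∃ C : ℕ → ℕ → ℕ,
      (∀ l a : ℕ, 0 < C l a) ∧
      ∀ (l : ℕ) (hl : 0 < l) (d a : ℕ) (e : Fin l → ℕ) (t : ℤ),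
        0 < d → 0 < a → (∀ i, 0 < e i) →
        (∀ i j : Fin l, i ≤ j → e j ≤ e i) →
        (∀ i, e i ∣ d) →
        ((∑ i : Fin l, (d : ℚ) / (e i : ℚ)) - 1 = (d : ℚ) * (t : ℚ) / (a : ℚ)) →
        (d : ℚ) / (C l a : ℚ) ≤ (e ⟨0, hl⟩ : ℚ) := by
  choose B hB hbound using exists_bound_of_sum_inv_sub_inv_eq
  refine ⟨fun l a => B (l - 1) a, fun l a => hB _ _, ?_⟩
  intro l hl d a e t hd ha he hanti hdvd h
  obtain ⟨l, rfl⟩ := Nat.exists_eq_succ_of_ne_zero hl.ne'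
  have hd' : (0 : ℚ) < d := by exact_mod_cast hd
  have hdiv : ∑ i, (1 : ℚ) / e i - 1 / d = t / a := by
    have h1 : ∑ i, (d : ℚ) / e i = d * ∑ i, (1 : ℚ) / e i := by
      rw [Finset.mul_sum]
      exact Finset.sum_congr rfl fun i _ => by ring
    rw [h1] at h
    apply mul_left_cancel₀ hd'.ne'
    rw [mul_sub, mul_one_div_cancel hd'.ne', h, mul_div_assoc]
  have hle := hbound l a d a e t hd ha le_rfl he (fun i j hij => hanti i j hij)
    (fun i => Nat.le_of_dvd hd (hdvd i)) hdiv
  have hBpos : (0 : ℚ) < B l a := by exact_mod_cast hB l a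
  change (d : ℚ) / (B l a : ℚ) ≤ (e 0 : ℚ)
  rw [div_le_iff₀' hBpos]
  exact_mod_cast hle
end
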